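/- arXiv:2210.06842 — 2 statements merged into one kernel-verified Lean document; each statement's English description precedes it below -/
import Mathlib

section
/- If a d-copula C admits a tail dependence function Λ(·; C), then Λ(·; C) is a concave function on [0,∞)^d. -/
open Filter Set

/-- A `d`-copula: grounded, uniform margins, and `d`-increasing. -/
def IsCopula {d : ℕ} (C : (Fin d → ℝ) → ℝ) : Prop :=
  (∀ u : Fin d → ℝ, (∀ k, u k ∈ Icc (0:ℝ) 1) → C u ∈ Icc (0:ℝ) 1) ∧
  (∀ u : Fin d → ℝ, (∀ k, u k ∈ Icc (0:ℝ) 1) → (∃ k, u k = 0) → C u = 0) ∧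
  (∀ u : Fin d → ℝ, (∀ k, u k ∈ Icc (0:ℝ) 1) → ∀ k, (∀ l, l ≠ k → u l = 1) → C u = u k) ∧
  (∀ a b : Fin d → ℝ, (∀ k, 0 ≤ a k) → (∀ k, a k ≤ b k) → (∀ k, b k ≤ 1) →
    0 ≤ ∑ v : Fin d → Bool,
      (-1 : ℝ) ^ (Finset.univ.filter fun k => v k = false).card *
        C (fun k => if v k then b k else a k))

/-- The tail dependence function `Λ(w; C) = lim_{s↓0} C(sw)/s` exists for all `w ∈ [0,∞)^d`
and equals `Λ`. -/
def HasTDF {d : ℕ} (C : (Fin d → ℝ) → ℝ) (Λ : (Fin d → ℝ) → ℝ) : Prop :=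
  ∀ w : Fin d → ℝ, (∀ k, 0 ≤ w k) →
    Tendsto (fun s : ℝ => C (fun k => s * w k) / s) (nhdsWithin 0 (Ioi 0)) (nhds (Λ w))

open Topology in
lemma aux_cont {d : ℕ} (f : (Fin d → ℝ) → ℝ)
    (hm : ∀ x y : Fin d → ℝ, 0 ≤ x → x ≤ y → f x ≤ f y)
    (hh : ∀ (t : ℝ) (x : Fin d → ℝ), 0 < t → 0 ≤ x → f (fun k => t * x k) = t * f x)
    (w : Fin d → ℝ) (hw : ∀ k, 0 < w k) : ContinuousAt f w := by
  have hw0 : (0 : Fin d → ℝ) ≤ w := fun k => (hw k).le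
  have hcoord : ∀ k, Tendsto (fun w' : Fin d → ℝ => w' k) (𝓝 w) (𝓝 (w k)) :=
    fun k => (continuous_apply k).continuousAt
  have hpos : ∀ᶠ w' in 𝓝 w, ∀ k, 0 < w' k :=
    eventually_all.2 fun k => (hcoord k).eventually (lt_mem_nhds (hw k))
  have ht : Tendsto (fun t : ℝ => t * f w) (𝓝 1) (𝓝 (f w)) := by
    have : Continuous (fun t : ℝ => t * f w) := by fun_prop
    simpa using this.tendsto 1
  refine tendsto_order.2 ⟨fun c hc => ?_, fun c hc => ?_⟩
  · have h1 : ∀ᶠ t : ℝ in 𝓝[<] 1, c < t * f w :=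
      (ht.mono_left nhdsWithin_le_nhds).eventually (lt_mem_nhds hc)
    have h2 : ∀ᶠ t : ℝ in 𝓝[<] 1, 0 < t :=
      (lt_mem_nhds (zero_lt_one)).filter_mono nhdsWithin_le_nhds
    obtain ⟨t, h1, h2, h3⟩ := (h1.and (h2.and self_mem_nhdsWithin)).exists
    have h3 : t < 1 := h3
    have : ∀ᶠ w' in 𝓝 w, ∀ k, t * w k < w' k :=
      eventually_all.2 fun k => (hcoord k).eventually
        (lt_mem_nhds (by nlinarith [hw k]))
    filter_upwards [this] with w' hw'
    refine h1.trans_le ?_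
    rw [← hh t w h2 hw0]
    exact hm _ _ (fun k => (mul_pos h2 (hw k)).le) (fun k => (hw' k).le)
  · have h1 : ∀ᶠ t : ℝ in 𝓝[>] 1, t * f w < c :=
      (ht.mono_left nhdsWithin_le_nhds).eventually (gt_mem_nhds hc)
    obtain ⟨t, h1, h3⟩ := (h1.and self_mem_nhdsWithin).exists
    have h3 : 1 < t := h3
    have : ∀ᶠ w' in 𝓝 w, ∀ k, w' k < t * w k :=
      eventually_all.2 fun k => (hcoord k).eventually
        (gt_mem_nhds (by nlinarith [hw k]))
    filter_upwards [this, hpos] with w' hw' hp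
    refine lt_of_le_of_lt ?_ h1
    rw [← hh t w (by linarith) hw0]
    exact hm _ _ (fun k => (hp k).le) (fun k => (hw' k).le)

open Topology in
lemma aux_freq {a b : ℝ → ℝ} {F q r : ℝ} (hr : 0 < r) (hr1 : r < 1) (hq : F < q)
    (hb0 : ∀ e, 0 < e → 0 ≤ b e) (hbF : ∀ e, 0 < e → b e ≤ F)
    (hab : ∀ e, 0 < e → a e + b e ≤ F) :
    ∃ᶠ z in 𝓝[>] r, a ((z - r) / r) + b ((z - r) / (1 - z)) < q := by
  set L := limsup b (𝓝[>] (0:ℝ)) with hL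
  have hbd : IsBoundedUnder (· ≤ ·) (𝓝[>] (0:ℝ)) b :=
    isBoundedUnder_of_eventually_le (a := F)
      (by filter_upwards [self_mem_nhdsWithin] with e he using hbF e he)
  have hbd' : IsCoboundedUnder (· ≤ ·) (𝓝[>] (0:ℝ)) b :=
    IsBoundedUnder.isCoboundedUnder_le (isBoundedUnder_of_eventually_ge (a := 0)
      (by filter_upwards [self_mem_nhdsWithin] with e he using hb0 e he))
  have h1 : ∀ᶠ e in 𝓝[>] (0:ℝ), b e < L + (q - F) / 2 :=
    eventually_lt_of_limsup_lt (by linarith) hbd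
  have h2 : ∃ᶠ e in 𝓝[>] (0:ℝ), L - (q - F) / 2 < b e :=
    frequently_lt_of_lt_limsup hbd' (by linarith)
  have hk : Tendsto (fun z : ℝ => (z - r) / (1 - z)) (𝓝[>] r) (𝓝[>] 0) := by
    refine tendsto_nhdsWithin_iff.2 ⟨?_, ?_⟩
    · have : ContinuousAt (fun z : ℝ => (z - r) / (1 - z)) r :=
        ContinuousAt.div (by fun_prop) (by fun_prop) (by linarith)
      have h := this.tendsto
      simp only [sub_self, zero_div] at h
      exact h.mono_left nhdsWithin_le_nhds
    · have : ∀ᶠ z in 𝓝[>] r, z < 1 := (gt_mem_nhds hr1).filter_mono nhdsWithin_le_nhds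
      filter_upwards [this, self_mem_nhdsWithin] with z hz hz'
      exact div_pos (sub_pos.2 hz') (sub_pos.2 hz)
  have hg : Tendsto (fun e : ℝ => r + r * e) (𝓝[>] 0) (𝓝[>] r) := by
    refine tendsto_nhdsWithin_iff.2 ⟨?_, ?_⟩
    · have : Continuous (fun e : ℝ => r + r * e) := by fun_prop
      have h := this.tendsto 0
      simp only [mul_zero, add_zero] at h
      exact h.mono_left nhdsWithin_le_nhds
    · filter_upwards [self_mem_nhdsWithin] with e he
      have : 0 < r * e := mul_pos hr he
      show r < _
      linarith
  have h3 := hg.eventually (hk.eventually h1)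
  have h4 : ∀ᶠ e in 𝓝[>] (0:ℝ), 0 < e := self_mem_nhdsWithin
  refine hg.frequently ((h2.and_eventually (h3.and h4)).mono ?_)
  rintro e ⟨he, he', he0⟩
  have : (r + r * e - r) / r = e := by field_simp; ring
  rw [this]
  have := hab e he0
  linarith

open Topology in
lemma aux_main {d : ℕ} (f : (Fin d → ℝ) → ℝ)
    (hm : ∀ x y : Fin d → ℝ, 0 ≤ x → x ≤ y → f x ≤ f y)
    (hh : ∀ (t : ℝ) (x : Fin d → ℝ), 0 < t → 0 ≤ x → f (fun k => t * x k) = t * f x)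
    (hs : ∀ x y : Fin d → ℝ, 0 ≤ x → 0 ≤ y → f x + f y ≤ f (x ⊔ y) + f (x ⊓ y))
    (x : Fin d → ℝ) (p : ℝ) (hp : 0 < p) (hp1 : p ≤ 1 - p) (hx : ∀ k, p ≤ x k)
    (hx' : ∀ k, x k ≤ 1 - p) :
    f x + f (fun k => 1 - x k) ≤ f (fun _ => 1) := by
  set F := f (fun _ => 1) with hF
  have hc : ∀ t, 0 < t → f (fun _ => t) = t * F := by
    intro t ht
    have := hh t (fun _ => 1) ht (fun _ => zero_le_one)
    simpa using this
  set G : ℝ → ℝ := fun r => f (fun k => min (x k) r) - f (fun k => min (1 - x k) (1 - r)) with hG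
  have hGc : ContinuousOn G (Icc p (1 - p)) := by
    intro r hr
    apply ContinuousAt.continuousWithinAt
    refine ContinuousAt.sub ?_ ?_
    · refine ContinuousAt.comp (f := fun r => fun k => min (x k) r) (g := f)
        (aux_cont f hm hh _ ?_) (by fun_prop)
      intro k
      exact lt_min (hp.trans_le (hx k)) (hp.trans_le hr.1)
    · refine ContinuousAt.comp (f := fun r => fun k => min (1 - x k) (1 - r)) (g := f)
        (aux_cont f hm hh _ ?_) (by fun_prop)
      intro k
      exact lt_min (by linarith [hx' k]) (by linarith [hr.2])
  have key : ∀ r ∈ Ico p (1 - p), ∀ q, F < q → ∃ᶠ z in 𝓝[>] r, slope G r z < q := by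
    intro r hr q hq
    have hr0 : 0 < r := hp.trans_le hr.1
    have hr1 : r < 1 := by linarith [hr.2]
    set A : Fin d → ℝ := fun k => if r < x k then 1 else 0 with hA
    set B : Fin d → ℝ := fun k => if r < x k then 0 else 1 with hB
    set a : ℝ → ℝ := fun e => (f (fun k => 1 + e * A k) - F) / e with ha
    set b : ℝ → ℝ := fun e => (f (fun k => 1 + e * B k) - F) / e with hb
    have hA0 : ∀ k, 0 ≤ A k := fun k => by simp only [hA]; split_ifs <;> norm_num
    have hB0 : ∀ k, 0 ≤ B k := fun k => by simp only [hB]; split_ifs <;> norm_num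
    have hA1 : ∀ k, A k ≤ 1 := fun k => by simp only [hA]; split_ifs <;> norm_num
    have hB1 : ∀ k, B k ≤ 1 := fun k => by simp only [hB]; split_ifs <;> norm_num
    have hfr := aux_freq (a := a) (b := b) hr0 hr1 hq ?_ ?_ ?_
    · have e1 : ∀ᶠ z in 𝓝[>] r, ∀ k, r < x k → z ≤ x k := by
        refine eventually_all.2 fun k => ?_
        by_cases h : r < x k
        · filter_upwards [(gt_mem_nhds h).filter_mono nhdsWithin_le_nhds] with z hz _ using hz.le
        · exact Eventually.of_forall fun z hz => absurd hz h
      have e2 : ∀ᶠ z in 𝓝[>] r, z < 1 := (gt_mem_nhds hr1).filter_mono nhdsWithin_le_nhds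
      have e3 : ∀ᶠ z in 𝓝[>] r, r < z := self_mem_nhdsWithin
      refine (hfr.and_eventually (e1.and (e2.and e3))).mono ?_
      rintro z ⟨hz, h1, h2, h3⟩
      have hd : 0 < z - r := sub_pos.2 h3
      have hs1 : 0 < 1 - z := sub_pos.2 h2
      rw [slope_def_field, div_lt_iff₀ hd]
      have i1 : f (fun k => min (x k) z) - f (fun k => min (x k) r)
          ≤ (z - r) * a ((z - r) / r) := by
        have t1 := hs (fun k => min (x k) z) (fun _ => r)
          (fun k => le_min (hp.le.trans (hx k)) (hr0.trans h3).le) (fun _ => hr0.le)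
        have t2 : ((fun k => min (x k) z) ⊓ (fun _ => r) : Fin d → ℝ) = fun k => min (x k) r := by
          funext k
          simp only [Pi.inf_apply]
          rw [min_assoc, min_eq_right h3.le]
        have t3 : f ((fun k => min (x k) z) ⊔ (fun _ => r)) ≤
            f (fun k => r * (1 + ((z - r) / r) * A k)) := by
          apply hm
          · intro k; exact le_sup_of_le_right hr0.le
          · intro k
            have : r * (1 + ((z - r) / r) * A k) = r + (z - r) * A k := by field_simp
            simp only [Pi.sup_apply]
            rw [this]
            simp only [hA]
            split_ifs with h
            · refine max_le ((min_le_right _ _).trans ?_) ?_ <;> linarith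
            · refine max_le ((min_le_left _ _).trans ?_) ?_ <;> linarith
        rw [hh r _ hr0 (fun k => by
          have := hA0 k
          show (0:ℝ) ≤ 1 + (z - r) / r * A k
          positivity)] at t3
        rw [t2, hc r hr0] at t1
        have : (z - r) * a ((z - r) / r) =
          r * f (fun k => 1 + (z - r) / r * A k) - r * F := by
          simp only [ha]; field_simp
        linarith
      have i2 : f (fun k => min (1 - x k) (1 - r)) - f (fun k => min (1 - x k) (1 - z))
          ≤ (z - r) * b ((z - r) / (1 - z)) := by
        have t1 := hs (fun k => min (1 - x k) (1 - r)) (fun _ => 1 - z)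
          (fun k => le_min (by simp only [Pi.zero_apply]; linarith [hx' k])
            (by simp only [Pi.zero_apply]; linarith)) (fun _ => hs1.le)
        have t2 : ((fun k => min (1 - x k) (1 - r)) ⊓ (fun _ => 1 - z) : Fin d → ℝ)
            = fun k => min (1 - x k) (1 - z) := by
          funext k
          simp only [Pi.inf_apply]
          rw [min_assoc, min_eq_right (by linarith : 1 - z ≤ 1 - r)]
        have t3 : f ((fun k => min (1 - x k) (1 - r)) ⊔ (fun _ => 1 - z)) ≤
            f (fun k => (1 - z) * (1 + ((z - r) / (1 - z)) * B k)) := by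
          apply hm
          · intro k; exact le_sup_of_le_right hs1.le
          · intro k
            have : (1 - z) * (1 + ((z - r) / (1 - z)) * B k) = (1 - z) + (z - r) * B k := by
              field_simp
            simp only [Pi.sup_apply]
            rw [this]
            simp only [hB]
            split_ifs with h
            · have := h1 k h
              refine max_le ((min_le_left _ _).trans ?_) ?_ <;> linarith
            · refine max_le ((min_le_right _ _).trans ?_) ?_ <;> linarith
        rw [hh (1 - z) _ hs1 (fun k => by
          have := hB0 k
          show (0:ℝ) ≤ 1 + (z - r) / (1 - z) * B k
          positivity)] at t3
        rw [t2, hc (1 - z) hs1] at t1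
        have : (z - r) * b ((z - r) / (1 - z)) =
          (1 - z) * f (fun k => 1 + (z - r) / (1 - z) * B k) - (1 - z) * F := by
          simp only [hb]; field_simp
        linarith
      have : (z - r) * (a ((z - r) / r) + b ((z - r) / (1 - z))) < (z - r) * q :=
        mul_lt_mul_of_pos_left hz hd
      simp only [hG]
      linarith
    · intro e he
      refine div_nonneg (sub_nonneg.2 (hm _ _ (fun _ => zero_le_one) fun k => ?_)) he.le
      have := mul_nonneg he.le (hB0 k)
      show (1:ℝ) ≤ _
      linarith
    · intro e he
      rw [div_le_iff₀ he]
      have : f (fun k => 1 + e * B k) ≤ f (fun _ => 1 + e) := by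
        refine hm _ _ (fun k => ?_) (fun k => ?_)
        · have := mul_nonneg he.le (hB0 k)
          show (0:ℝ) ≤ _
          linarith
        · have := mul_le_mul_of_nonneg_left (hB1 k) he.le
          show 1 + e * B k ≤ _
          linarith
      rw [hc (1 + e) (by linarith)] at this
      linarith
    · intro e he
      rw [ha, hb]
      simp only
      rw [← add_div, div_le_iff₀ he]
      have t := hs (fun k => 1 + e * A k) (fun k => 1 + e * B k)
        (fun k => by
          have := mul_nonneg he.le (hA0 k)
          show (0:ℝ) ≤ _
          linarith)
        (fun k => by
          have := mul_nonneg he.le (hB0 k)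
          show (0:ℝ) ≤ _
          linarith)
      have t1 : ((fun k => 1 + e * A k) ⊔ (fun k => 1 + e * B k) : Fin d → ℝ)
          = fun _ => 1 + e := by
        funext k
        simp only [Pi.sup_apply, hA, hB]
        split_ifs <;> simp [he.le]
      have t2 : ((fun k => 1 + e * A k) ⊓ (fun k => 1 + e * B k) : Fin d → ℝ)
          = fun _ => 1 := by
        funext k
        simp only [Pi.inf_apply, hA, hB]
        split_ifs <;> simp [he.le]
      rw [t1, t2, hc (1 + e) (by linarith)] at t
      linarith
  have hfin := image_le_of_liminf_slope_right_le_deriv_boundary (f := G) (a := p) (b := 1 - p)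
    (B := fun r => G p + (r - p) * F) (B' := fun _ => F) hGc (by simp) (by fun_prop)
    (fun r _ => by
      have : HasDerivAt (fun r : ℝ => G p + (r - p) * F) (1 * F) r :=
        (((hasDerivAt_id r).sub_const p).mul_const F).const_add (G p)
      rw [one_mul] at this
      exact this.hasDerivWithinAt) key (right_mem_Icc.2 hp1)
  have g1 : G (1 - p) = f x - p * F := by
    simp only [hG]
    rw [← hc p hp]
    congr 2
    · funext k; exact min_eq_left (hx' k)
    · funext k
      rw [min_eq_right (by linarith [hx' k])]; ring
  have g2 : G p = p * F - f (fun k => 1 - x k) := by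
    simp only [hG]
    rw [← hc p hp]
    congr 2
    · funext k; exact min_eq_right (hx k)
    · funext k
      rw [min_eq_left (by linarith [hx k])]
  rw [g1] at hfin
  simp only [g2] at hfin
  linarith

open Function in
lemma cop_mono {d : ℕ} {C : (Fin d → ℝ) → ℝ} (hC : IsCopula C) (u : Fin d → ℝ) (i : Fin d)
    (hu : ∀ k, u k ∈ Icc (0:ℝ) 1) (α : ℝ) (h0 : 0 ≤ α) (h1 : α ≤ u i) :
    C (update u i α) ≤ C u := by
  obtain ⟨-, hg, -, hinc⟩ := hC
  have H := hinc (update 0 i α) u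
    (fun k => by by_cases h : k = i <;> simp [update_apply, h, h0])
    (fun k => by
      by_cases h : k = i
      · subst h; simpa using h1
      · simpa [update_apply, h] using (hu k).1) (fun k => (hu k).2)
  set T : Fin d → Bool := fun _ => true with hT
  have hne : T ≠ update T i false := fun h => by
    have := congrFun h i; simp [hT] at this
  rw [← Finset.sum_subset (Finset.subset_univ {T, update T i false})] at H
  · rw [Finset.sum_pair hne] at H
    have f1 : (Finset.univ.filter fun k => T k = false) = ∅ := by
      ext k; simp [hT]
    have f2 : (Finset.univ.filter fun k => update T i false k = false) = {i} := by
      ext k; by_cases h : k = i <;> simp [hT, update_apply, h]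
    have c1 : (fun k => if T k = true then u k else update (0 : Fin d → ℝ) i α k) = u := by
      funext k; simp [hT]
    have c2 : (fun k => if update T i false k = true then u k
        else update (0 : Fin d → ℝ) i α k) = update u i α := by
      funext k; by_cases h : k = i <;> simp [hT, update_apply, h]
    rw [f1, f2, c1, c2] at H
    simp at H
    linarith
  · intro v _ hv
    have : ∃ k, k ≠ i ∧ v k = false := by
      by_contra! hcon
      apply hv
      have hc : ∀ k, k ≠ i → v k = true := fun k hk => by simpa using hcon k hk
      simp only [Finset.mem_insert, Finset.mem_singleton]
      cases hvi : v i
      · right; funext k; by_cases h : k = i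
        · subst h; simp [hvi]
        · simp [update_apply, h, hT, hc k h]
      · left; funext k; by_cases h : k = i
        · subst h; simp [hvi, hT]
        · simp [hT, hc k h]
    obtain ⟨k, hk, hvk⟩ := this
    rw [hg, mul_zero]
    · intro l
      by_cases hl : v l = true
      · simpa [hl] using hu l
      · by_cases h : l = i
        · subst h; simp [hl, h0, h1.trans (hu l).2]
        · simp [hl, update_apply, h]
    · exact ⟨k, by simp [hvk, update_apply, hk]⟩

open Function in
lemma cop_sup {d : ℕ} {C : (Fin d → ℝ) → ℝ} (hC : IsCopula C) (u : Fin d → ℝ) (i j : Fin d)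
    (hij : i ≠ j)
    (hu : ∀ k, u k ∈ Icc (0:ℝ) 1) (α β : ℝ) (h0 : 0 ≤ α) (h1 : α ≤ u i)
    (g0 : 0 ≤ β) (g1 : β ≤ u j) :
    C (update u i α) + C (update u j β) ≤ C u + C (update (update u i α) j β) := by
  obtain ⟨-, hg, -, hinc⟩ := hC
  have hji := hij.symm
  have ha : ∀ k, 0 ≤ update (update (0 : Fin d → ℝ) i α) j β k := fun k => by
    by_cases h : k = j
    · simp [h, g0]
    · by_cases h' : k = i <;> simp [update_apply, h, h', h0, hij]
  have hab : ∀ k, update (update (0 : Fin d → ℝ) i α) j β k ≤ u k := fun k => by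
    by_cases h : k = j
    · subst h; simpa using g1
    · by_cases h' : k = i
      · subst h'; simpa [update_apply, h] using h1
      · simpa [update_apply, h, h'] using (hu k).1
  have H := hinc (update (update 0 i α) j β) u ha hab (fun k => (hu k).2)
  set T : Fin d → Bool := fun _ => true with hT
  have n1 : T ∉ ({update T i false, update T j false, update (update T i false) j false} :
      Finset (Fin d → Bool)) := by
    simp only [Finset.mem_insert, Finset.mem_singleton, not_or]
    refine ⟨fun h => ?_, fun h => ?_, fun h => ?_⟩
    · have := congrFun h i; simp [hT] at this
    · have := congrFun h j; simp [hT] at this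
    · have := congrFun h j; simp [hT] at this
  have n2 : update T i false ∉ ({update T j false, update (update T i false) j false} :
      Finset (Fin d → Bool)) := by
    simp only [Finset.mem_insert, Finset.mem_singleton, not_or]
    refine ⟨fun h => ?_, fun h => ?_⟩
    · have := congrFun h i; simp [hT, hij] at this
    · have := congrFun h j; simp [hT, hji] at this
  have n3 : update T j false ≠ update (update T i false) j false := fun h => by
    have := congrFun h i; simp [hT, hij] at this
  rw [← Finset.sum_subset (Finset.subset_univ
    {T, update T i false, update T j false, update (update T i false) j false})] at H
  · rw [Finset.sum_insert n1, Finset.sum_insert n2, Finset.sum_pair n3] at H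
    have f1 : (Finset.univ.filter fun k => T k = false) = ∅ := by
      ext k; simp [hT]
    have f2 : ∀ i, (Finset.univ.filter fun k => update T i false k = false) = {i} := by
      intro i; ext k; by_cases h : k = i <;> simp [hT, update_apply, h]
    have f3 : (Finset.univ.filter fun k => update (update T i false) j false k = false)
        = {i, j} := by
      ext k; by_cases h : k = i <;> by_cases h' : k = j <;> simp [hT, update_apply, h, h']
    have c1 : (fun k => if T k = true then u k
        else update (update (0 : Fin d → ℝ) i α) j β k) = u := by
      funext k; simp [hT]
    have c2 : (fun k => if update T i false k = true then u k
        else update (update (0 : Fin d → ℝ) i α) j β k) = update u i α := by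
      funext k; by_cases h : k = i <;> simp [hT, update_apply, h, hij]
    have c3 : (fun k => if update T j false k = true then u k
        else update (update (0 : Fin d → ℝ) i α) j β k) = update u j β := by
      funext k; by_cases h : k = j <;> simp [hT, update_apply, h]
    have c4 : (fun k => if update (update T i false) j false k = true then u k
        else update (update (0 : Fin d → ℝ) i α) j β k) = update (update u i α) j β := by
      funext k
      by_cases h : k = j
      · simp [h]
      · by_cases h' : k = i <;> simp [hT, update_apply, h, h', hij]
    rw [f1, f2, f2, f3, c1, c2, c3, c4, Finset.card_pair hij] at H
    simp at H
    linarith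
  · intro v _ hv
    have : ∃ k, k ≠ i ∧ k ≠ j ∧ v k = false := by
      by_contra! hcon
      apply hv
      have hc : ∀ k, k ≠ i → k ≠ j → v k = true := fun k hk hk' => by simpa using hcon k hk hk'
      have hv' : v = update (update T i (v i)) j (v j) := by
        funext k
        by_cases h : k = j
        · simp [h]
        · by_cases h' : k = i
          · simp [update_apply, h', hij]
          · simp [update_apply, h, h', hT, hc k h' h]
      have u1 : ∀ i, update T i true = T := fun i => update_eq_self i T
      have u2 : update (update T i false) j true = update T i false := by
        funext k; by_cases h : k = j <;> simp [update_apply, h, hT, hji]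
      simp only [Finset.mem_insert, Finset.mem_singleton]
      rw [hv']
      cases v i <;> cases v j <;> simp [u1, u2]
    obtain ⟨k, hk, hk', hvk⟩ := this
    rw [hg, mul_zero]
    · intro l
      by_cases hl : v l = true
      · simpa [hl] using hu l
      · simpa [hl] using And.intro (ha l) ((hab l).trans (hu l).2)
    · exact ⟨k, by simp [hvk, update_apply, hk, hk']⟩

open Function in
lemma lam_mono {d : ℕ} (f : (Fin d → ℝ) → ℝ)
    (h1 : ∀ (w : Fin d → ℝ) (i : Fin d) (α : ℝ), 0 ≤ w → 0 ≤ α → α ≤ w i →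
      f (update w i α) ≤ f w)
    (x y : Fin d → ℝ) (hx : 0 ≤ x) (hxy : x ≤ y) : f x ≤ f y := by
  have : ∀ S : Finset (Fin d), f x ≤ f (S.piecewise y x) := by
    intro S
    induction S using Finset.induction_on with
    | empty => simp
    | insert i S hi ih =>
      refine ih.trans ?_
      have e : S.piecewise y x = update ((insert i S).piecewise y x) i (x i) := by
        funext k
        by_cases h : k = i
        · subst h; simp [hi]
        · simp [update_apply, h, Finset.piecewise]
      rw [e]
      refine h1 _ _ _ ?_ (hx i) ?_
      · intro k
        by_cases h : k ∈ insert i S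
        · rw [Finset.piecewise_eq_of_mem _ _ _ h]; exact (hx k).trans (hxy k)
        · rw [Finset.piecewise_eq_of_notMem _ _ _ h]; exact hx k
      · simpa using hxy i
  simpa using this Finset.univ

open Function in
lemma lam_incr {d : ℕ} (f : (Fin d → ℝ) → ℝ)
    (h2 : ∀ (w : Fin d → ℝ) (i j : Fin d) (α β : ℝ), i ≠ j → 0 ≤ w → 0 ≤ α → α ≤ w i →
      0 ≤ β → β ≤ w j →
      f (update w i α) + f (update w j β) ≤ f w + f (update (update w i α) j β))
    (x y : Fin d → ℝ) (hx : 0 ≤ x) (hxy : x ≤ y) (i : Fin d) (α β : ℝ) (hα : 0 ≤ α)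
    (hαβ : α ≤ β) :
    f (update x i β) - f (update x i α) ≤ f (update y i β) - f (update y i α) := by
  have : ∀ S : Finset (Fin d), f (update x i β) - f (update x i α) ≤
      f (update (S.piecewise y x) i β) - f (update (S.piecewise y x) i α) := by
    intro S
    induction S using Finset.induction_on with
    | empty => simp
    | insert j S hj ih =>
      refine ih.trans ?_
      by_cases hji : j = i
      · subst hji
        have : ∀ γ, update (S.piecewise y x) j γ = update ((insert j S).piecewise y x) j γ := by
          intro γ
          funext k
          by_cases h : k = j
          · subst h; simp
          · simp [update_apply, h, Finset.piecewise]
        rw [this, this]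
      · have hij : i ≠ j := fun h => hji h.symm
        have e : ∀ γ, update (S.piecewise y x) i γ
            = update (update ((insert j S).piecewise y x) i γ) j (x j) := by
          intro γ
          funext k
          by_cases h : k = j
          · subst h; simp [hj, update_apply, hji]
          · simp [update_apply, h, Finset.piecewise]
        have := h2 (update ((insert j S).piecewise y x) i β) i j α (x j) hij ?_ hα (by simpa)
          (hx j) ?_
        · rw [← e β, update_idem, ← e α] at this
          linarith
        · intro k
          by_cases h : k = i
          · subst h; simpa using hα.trans hαβ
          · rw [update_of_ne h]
            by_cases h : k ∈ insert j S
            · rw [Finset.piecewise_eq_of_mem _ _ _ h]; exact (hx k).trans (hxy k)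
            · rw [Finset.piecewise_eq_of_notMem _ _ _ h]; exact hx k
        · rw [update_of_ne hji]
          simpa using hxy j
  simpa using this Finset.univ

open Function in
lemma lam_super {d : ℕ} (f : (Fin d → ℝ) → ℝ)
    (h2 : ∀ (w : Fin d → ℝ) (i j : Fin d) (α β : ℝ), i ≠ j → 0 ≤ w → 0 ≤ α → α ≤ w i →
      0 ≤ β → β ≤ w j →
      f (update w i α) + f (update w j β) ≤ f w + f (update (update w i α) j β))
    (x y : Fin d → ℝ) (hx : 0 ≤ x) (hy : 0 ≤ y) : f x + f y ≤ f (x ⊔ y) + f (x ⊓ y) := by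
  have : ∀ S : Finset (Fin d), f (S.piecewise y (x ⊓ y)) - f (x ⊓ y) ≤
      f (S.piecewise (x ⊔ y) x) - f x := by
    intro S
    induction S using Finset.induction_on with
    | empty => simp
    | insert i S hi ih =>
      have hTU : S.piecewise y (x ⊓ y) ≤ S.piecewise (x ⊔ y) x := by
        intro k
        by_cases h : k ∈ S <;> simp [h]
      have hT0 : 0 ≤ S.piecewise y (x ⊓ y) := by
        intro k
        have h1 := hx k
        have h2 := hy k
        simp only [Pi.zero_apply] at h1 h2
        by_cases h : k ∈ S <;> simp [h, h1, h2]
      rw [Finset.piecewise_insert, Finset.piecewise_insert]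
      rcases le_total (y i) (x i) with h | h
      · have e1 : update (S.piecewise y (x ⊓ y)) i (y i) = S.piecewise y (x ⊓ y) := by
          apply update_eq_self_iff.2
          simp [hi, h]
        have e2 : update (S.piecewise (x ⊔ y) x) i ((x ⊔ y) i) = S.piecewise (x ⊔ y) x := by
          apply update_eq_self_iff.2
          simp [hi, h]
        rw [e1, e2]; exact ih
      · have := lam_incr f h2 _ _ hT0 hTU i (x i) (y i) (hx i) h
        have e1 : update (S.piecewise y (x ⊓ y)) i (x i) = S.piecewise y (x ⊓ y) := by
          apply update_eq_self_iff.2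
          simp [hi, h]
        have e2 : update (S.piecewise (x ⊔ y) x) i (x i) = S.piecewise (x ⊔ y) x := by
          apply update_eq_self_iff.2
          simp [hi]
        have e3 : (x ⊔ y) i = y i := by simp [h]
        rw [e1, e2] at this
        rw [e3]
        linarith
  have := this Finset.univ
  simp only [Finset.piecewise_univ] at this
  linarith

open Function Topology in
theorem stmt1 {d : ℕ} (C Λ : (Fin d → ℝ) → ℝ) (hC : IsCopula C) (hΛ : HasTDF C Λ) :
    ConcaveOn ℝ (Set.Ici (0 : Fin d → ℝ)) Λ := by
  refine ⟨convex_Ici 0, ?_⟩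
  have hsmall : ∀ w : Fin d → ℝ, 0 ≤ w →
      ∀ᶠ s in 𝓝[>] (0:ℝ), 0 < s ∧ ∀ k, s * w k ∈ Icc (0:ℝ) 1 := by
    intro w hw
    have : ∀ᶠ s in 𝓝[>] (0:ℝ), ∀ k, s * w k < 1 := by
      refine eventually_all.2 fun k => ?_
      have hc : Continuous fun s : ℝ => s * w k := by fun_prop
      have := hc.tendsto 0
      rw [zero_mul] at this
      exact (this.mono_left nhdsWithin_le_nhds).eventually (gt_mem_nhds one_pos)
    filter_upwards [this, self_mem_nhdsWithin] with s h1 h2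
    exact ⟨h2, fun k => ⟨mul_nonneg (le_of_lt h2) (hw k), (h1 k).le⟩⟩
  have hupd : ∀ (s : ℝ) (w : Fin d → ℝ) (i : Fin d) (α : ℝ),
      (fun k => s * update w i α k) = update (fun k => s * w k) i (s * α) := by
    intro s w i α
    funext k
    by_cases h : k = i <;> simp [update_apply, h]
  have hupd0 : ∀ (w : Fin d → ℝ) (i : Fin d) (α : ℝ), 0 ≤ w → 0 ≤ α → 0 ≤ update w i α := by
    intro w i α hw hα k
    by_cases h : k = i
    · subst h; simpa using hα
    · rw [update_of_ne h]; exact hw k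
  have h1 : ∀ (w : Fin d → ℝ) (i : Fin d) (α : ℝ), 0 ≤ w → 0 ≤ α → α ≤ w i →
      Λ (update w i α) ≤ Λ w := by
    intro w i α hw h0 h1
    refine le_of_tendsto_of_tendsto (hΛ _ (hupd0 w i α hw h0)) (hΛ w hw) ?_
    filter_upwards [hsmall w hw] with s hs
    rw [hupd]
    exact div_le_div_of_nonneg_right (cop_mono hC _ _ hs.2 _ (mul_nonneg hs.1.le h0)
      (mul_le_mul_of_nonneg_left h1 hs.1.le)) hs.1.le
  have h2 : ∀ (w : Fin d → ℝ) (i j : Fin d) (α β : ℝ), i ≠ j → 0 ≤ w → 0 ≤ α → α ≤ w i →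
      0 ≤ β → β ≤ w j →
      Λ (update w i α) + Λ (update w j β) ≤ Λ w + Λ (update (update w i α) j β) := by
    intro w i j α β hij hw h0 h1 g0 g1
    refine le_of_tendsto_of_tendsto
      ((hΛ _ (hupd0 w i α hw h0)).add (hΛ _ (hupd0 w j β hw g0)))
      ((hΛ w hw).add (hΛ _ (hupd0 _ j β (hupd0 w i α hw h0) g0))) ?_
    filter_upwards [hsmall w hw] with s hs
    rw [hupd, hupd, hupd, hupd, ← add_div, ← add_div]
    exact div_le_div_of_nonneg_right (cop_sup hC _ _ _ hij hs.2 _ _ (mul_nonneg hs.1.le h0)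
      (mul_le_mul_of_nonneg_left h1 hs.1.le) (mul_nonneg hs.1.le g0)
      (mul_le_mul_of_nonneg_left g1 hs.1.le)) hs.1.le
  have hm := lam_mono Λ h1
  have hs := lam_super Λ h2
  have hh : ∀ (t : ℝ) (x : Fin d → ℝ), 0 < t → 0 ≤ x →
      Λ (fun k => t * x k) = t * Λ x := by
    intro t x ht hx
    have e1 := hΛ (fun k => t * x k) (fun k => mul_nonneg ht.le (hx k))
    have hg : Tendsto (fun s : ℝ => s * t) (𝓝[>] 0) (𝓝[>] 0) := by
      refine tendsto_nhdsWithin_iff.2 ⟨?_, ?_⟩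
      · have : Continuous (fun s : ℝ => s * t) := by fun_prop
        have h := this.tendsto 0
        rw [zero_mul] at h
        exact h.mono_left nhdsWithin_le_nhds
      · filter_upwards [self_mem_nhdsWithin] with e he using mul_pos he ht
    have e2 := ((hΛ x hx).comp hg).const_mul t
    refine tendsto_nhds_unique e1 (e2.congr' ?_)
    filter_upwards [self_mem_nhdsWithin] with s hs
    have hs : 0 < s := hs
    simp only [comp_apply, mul_assoc]
    field_simp
  have hz : ∀ x : Fin d → ℝ, 0 ≤ x → (∃ k, x k = 0) → Λ x = 0 := by
    rintro x hx ⟨k, hk⟩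
    refine tendsto_nhds_unique (hΛ x hx) (tendsto_const_nhds.congr' ?_)
    filter_upwards [hsmall x hx] with s hs
    rw [hC.2.1 _ hs.2 ⟨k, by simp [hk]⟩, zero_div]
  intro x hx y hy a b ha hb hab
  have hx : 0 ≤ x := hx
  have hy : 0 ≤ y := hy
  rcases isEmpty_or_nonempty (Fin d) with hd | ⟨⟨k0⟩⟩
  · rw [Subsingleton.elim y x, ← add_smul, ← add_smul, hab, one_smul, one_smul]
  rcases ha.eq_or_lt with rfl | ha
  · have : b = 1 := by linarith
    simp [this]
  rcases hb.eq_or_lt with rfl | hb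
  · have : a = 1 := by linarith
    simp [this]
  have sup : ∀ x y : Fin d → ℝ, 0 ≤ x → 0 ≤ y → Λ x + Λ y ≤ Λ (x + y) := by
    intro x y hx hy
    by_cases hx0 : ∃ k, x k = 0
    · rw [hz x hx hx0, zero_add]
      exact hm _ _ hy (le_add_of_nonneg_left hx)
    by_cases hy0 : ∃ k, y k = 0
    · rw [hz y hy hy0, add_zero]
      exact hm _ _ hx (le_add_of_nonneg_right hy)
    push Not at hx0 hy0
    have hxp : ∀ k, 0 < x k := fun k => lt_of_le_of_ne (hx k) (hx0 k).symm
    have hyp : ∀ k, 0 < y k := fun k => lt_of_le_of_ne (hy k) (hy0 k).symm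
    have hzp : ∀ k, 0 < x k + y k := fun k => add_pos (hxp k) (hyp k)
    have hp : ∀ᶠ p in 𝓝[>] (0:ℝ), ∀ k, p < x k / (x k + y k) ∧ p < y k / (x k + y k) :=
      eventually_all.2 fun k => ((gt_mem_nhds (div_pos (hxp k) (hzp k))).and
        (gt_mem_nhds (div_pos (hyp k) (hzp k)))).filter_mono nhdsWithin_le_nhds
    obtain ⟨p, hp, hp0⟩ := (hp.and self_mem_nhdsWithin).exists
    have hsum : ∀ k, 1 - x k / (x k + y k) = y k / (x k + y k) := by
      intro k
      have := (hzp k).ne'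
      field_simp
      ring
    have M := aux_main (fun u => Λ (fun k => (x k + y k) * u k)) ?_ ?_ ?_
      (fun k => x k / (x k + y k)) p hp0 ?_ (fun k => (hp k).1.le) ?_
    · simp only [hsum, mul_one] at M
      have c1 : (fun k => (x k + y k) * (x k / (x k + y k))) = x := by
        funext k
        have := (hzp k).ne'
        field_simp
      have c2 : (fun k => (x k + y k) * (y k / (x k + y k))) = y := by
        funext k
        have := (hzp k).ne'
        field_simp
      rw [c1, c2] at M
      exact M
    · intro u v hu huv
      exact hm _ _ (fun k => mul_nonneg (hzp k).le (hu k))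
        (fun k => mul_le_mul_of_nonneg_left (huv k) (hzp k).le)
    · intro t u ht hu
      simp only
      rw [← hh t _ ht (fun k => mul_nonneg (hzp k).le (hu k))]
      congr 1
      funext k
      ring
    · intro u v hu hv
      have := hs _ _ (fun k => mul_nonneg (hzp k).le (hu k))
        (fun k => mul_nonneg (hzp k).le (hv k))
      refine this.trans (le_of_eq ?_)
      congr 2
      · funext k
        simp only [Pi.sup_apply]
        exact (mul_max_of_nonneg _ _ (hzp k).le).symm
      · funext k
        simp only [Pi.inf_apply]
        exact (mul_min_of_nonneg _ _ (hzp k).le).symm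
    · have := hp k0
      have := hsum k0
      linarith
    · intro k
      have := hp k
      have := hsum k
      show x k / (x k + y k) ≤ _
      linarith
  have e1 : a • Λ x = Λ (a • x) := (hh a x ha hx).symm
  have e2 : b • Λ y = Λ (b • y) := (hh b y hb hy).symm
  rw [e1, e2]
  exact sup _ _ (smul_nonneg ha.le hx) (smul_nonneg hb.le hy)
end

section
/- Let C1 and C2 be Archimedean d-copulas with generators φ1 and φ2 that are regularly varying at 0 (with indices −α1 and −α2, α1, α2 ∈ [0,∞]). If C1 <_Λ C2 (i.e. Λ(w; C1) < Λ(w; C2) for all w ∈ (0,∞)^d), then C1 ≤_loc C2, i.e. there exists ε > 0 such that C1(u) ≤ C2(u) for all u ∈ [0,1]^d with ‖u‖ < ε. -/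
open Filter Set

/-- An Archimedean generator: continuous, strictly decreasing on `(0,1]` with `φ(1) = 0`
(the value at `0` may be `∞`, i.e. `φ` may be unbounded near `0`). -/
def IsGenerator (φ : ℝ → ℝ) : Prop :=
  ContinuousOn φ (Ioc (0:ℝ) 1) ∧ StrictAntiOn φ (Ioc (0:ℝ) 1) ∧ φ 1 = 0

/-- A strict generator: `φ(s) → ∞` as `s ↓ 0`. -/
def IsStrictGenerator (φ : ℝ → ℝ) : Prop :=
  IsGenerator φ ∧ Tendsto φ (nhdsWithin 0 (Ioi 0)) atTop

/-- The generalized inverse `φ^{[-1]}(x) = inf {t ∈ (0,1] : φ(t) ≤ x}` (for a strict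
generator this is the ordinary inverse of `φ : (0,1] → [0,∞)`). -/
noncomputable def geninv (φ : ℝ → ℝ) (x : ℝ) : ℝ :=
  sInf {t | t ∈ Ioc (0:ℝ) 1 ∧ φ t ≤ x}

/-- `C` is the Archimedean `d`-copula generated by `φ`:
`C(u) = φ^{[-1]}(∑ₖ φ(uₖ))` on `(0,1]^d`, and `C(u) = 0` whenever some coordinate is `0`. -/
def IsArchimedean {d : ℕ} (C : (Fin d → ℝ) → ℝ) (φ : ℝ → ℝ) : Prop :=
  (∀ u : Fin d → ℝ, (∀ k, u k ∈ Ioc (0:ℝ) 1) → C u = geninv φ (∑ k, φ (u k))) ∧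
  (∀ u : Fin d → ℝ, (∀ k, u k ∈ Icc (0:ℝ) 1) → (∃ k, u k = 0) → C u = 0)

/-- `φ` is regularly varying at `0` with index `-α` (for `α ∈ [0,∞)`):
`φ(ts)/φ(s) → t^(-α)` as `s ↓ 0`, for every `t > 0`. -/
def RegVarAtZero (φ : ℝ → ℝ) (α : ℝ) : Prop :=
  ∀ t : ℝ, 0 < t →
    Tendsto (fun s : ℝ => φ (t * s) / φ s) (nhdsWithin 0 (Ioi 0)) (nhds (t ^ (-α)))

/-- `φ` is rapidly varying at `0` (index `-∞`): `φ(ts)/φ(s) → ∞` for `0 < t < 1` and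
`φ(ts)/φ(s) → 0` for `t > 1`, as `s ↓ 0`. -/
def RapidVarAtZero (φ : ℝ → ℝ) : Prop :=
  (∀ t : ℝ, 0 < t → t < 1 →
    Tendsto (fun s : ℝ => φ (t * s) / φ s) (nhdsWithin 0 (Ioi 0)) atTop) ∧
  (∀ t : ℝ, 1 < t →
    Tendsto (fun s : ℝ => φ (t * s) / φ s) (nhdsWithin 0 (Ioi 0)) (nhds 0))

/-- `φ` is regularly varying at `0` with index `-α` for the extended parameter
`α ∈ [0,∞]`. -/
def RegVarAtZeroE (φ : ℝ → ℝ) (α : ENNReal) : Prop :=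
  if α = ⊤ then RapidVarAtZero φ else RegVarAtZero φ α.toReal

theorem aux_midconvex {f : ℝ → ℝ} {s : Set ℝ} (hs : Convex ℝ s) (hc : ContinuousOn f s)
    (hm : ∀ x ∈ s, ∀ y ∈ s, x < y → f ((x + y) / 2) ≤ (f x + f y) / 2) : ConvexOn ℝ s f := by
  apply LinearOrder.convexOn_of_lt hs
  intro x hx y hy hxy a b ha hb hab
  simp only [smul_eq_mul]
  by_contra hcon
  push Not at hcon
  set m := (f y - f x) / (y - x) with hmdef
  set g : ℝ → ℝ := fun z => f z - (f x + m * (z - x)) with hg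
  have hsub : Icc x y ⊆ s := hs.ordConnected.out hx hy
  have hyx : 0 < y - x := by linarith
  have hmy : m * (y - x) = f y - f x := by rw [hmdef]; field_simp
  have hgx : g x = 0 := by simp [hg]
  have hgy : g y = 0 := by simp only [hg]; linarith
  have hgc : ContinuousOn g (Icc x y) := by
    apply (hc.mono hsub).sub
    fun_prop
  have hgm : ∀ p ∈ Icc x y, ∀ q ∈ Icc x y, p < q → g ((p + q) / 2) ≤ (g p + g q) / 2 := by
    intro p hp q hq hpq
    have := hm p (hsub hp) q (hsub hq) hpq
    simp only [hg]
    linarith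
  obtain ⟨c0, hc0, hmax⟩ := isCompact_Icc.exists_isMaxOn ⟨x, left_mem_Icc.2 hxy.le⟩ hgc
  have hz : a * x + b * y ∈ Icc x y := by
    have hba : b = 1 - a := by linarith
    subst hba
    constructor <;> nlinarith
  have hpos : 0 < g (a * x + b * y) := by
    simp only [hg]
    have : a * x + b * y - x = b * (y - x) := by
      have : a = 1 - b := by linarith
      subst this; ring
    rw [this]
    have h2 : m * (b * (y - x)) = b * (f y - f x) := by rw [← hmy]; ring
    rw [h2]
    have : a = 1 - b := by linarith
    subst this
    nlinarith
  have hM : 0 < g c0 := lt_of_lt_of_le hpos (hmax hz)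
  have hKc : IsCompact (Icc x y ∩ g ⁻¹' {g c0}) :=
    isCompact_Icc.of_isClosed_subset (hgc.preimage_isClosed_of_isClosed isClosed_Icc isClosed_singleton)
      inter_subset_left
  obtain ⟨c, ⟨hcI, hcg⟩, hcmin⟩ := hKc.exists_isLeast ⟨c0, hc0, rfl⟩
  have hcg' : g c = g c0 := hcg
  have hcx : x < c := lt_of_le_of_ne hcI.1 (by rintro rfl; linarith)
  have hcy : c < y := lt_of_le_of_ne hcI.2 (by rintro rfl; linarith)
  set h := min (c - x) (y - c) with hh
  have hhpos : 0 < h := lt_min (by linarith) (by linarith)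
  have h1 : h ≤ c - x := min_le_left _ _
  have h2 : h ≤ y - c := min_le_right _ _
  have hp : c - h ∈ Icc x y := ⟨by linarith, by linarith⟩
  have hq : c + h ∈ Icc x y := ⟨by linarith, by linarith⟩
  have key := hgm _ hp _ hq (by linarith)
  have e : (c - h + (c + h)) / 2 = c := by ring
  rw [e] at key
  have k1 : g (c + h) ≤ g c0 := hmax hq
  have k2 : g (c - h) ≤ g c0 := hmax hp
  have k3 : g (c - h) ≠ g c0 := fun hne => by
    have := hcmin ⟨hp, hne⟩
    linarith
  have := lt_of_le_of_ne k2 k3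
  linarith

theorem aux_geninv {φ : ℝ → ℝ} (hg : IsGenerator φ) {t : ℝ} (ht : t ∈ Ioc (0:ℝ) 1) :
    geninv φ (φ t) = t := by
  have : {r | r ∈ Ioc (0:ℝ) 1 ∧ φ r ≤ φ t} = Icc t 1 := by
    ext r
    constructor
    · rintro ⟨hr, h⟩
      exact ⟨(hg.2.1.le_iff_ge hr ht).1 h, hr.2⟩
    · rintro ⟨h1, h2⟩
      have hr : r ∈ Ioc (0:ℝ) 1 := ⟨lt_of_lt_of_le ht.1 h1, h2⟩
      exact ⟨hr, (hg.2.1.le_iff_ge hr ht).2 h1⟩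
  rw [geninv, this, csInf_Icc ht.2]

theorem aux_two {n : ℕ} {C : (Fin (n+2) → ℝ) → ℝ} (hC : IsCopula C) {a b a' b' : ℝ}
    (ha : 0 ≤ a) (hab : a ≤ b) (hb : b ≤ 1) (ha' : 0 ≤ a') (hab' : a' ≤ b') (hb' : b' ≤ 1) :
    C (Fin.cons a (Fin.cons b' fun _ => 1)) + C (Fin.cons b (Fin.cons a' fun _ => 1)) ≤
    C (Fin.cons a (Fin.cons a' fun _ => 1)) + C (Fin.cons b (Fin.cons b' fun _ => 1)) := by
  have h := hC.2.2.2 (Fin.cons a (Fin.cons a' fun _ => 0)) (Fin.cons b (Fin.cons b' fun _ => 1))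
    (by intro k; refine Fin.cases ?_ (fun k => ?_) k; · simpa
        refine Fin.cases ?_ (fun k => ?_) k <;> simp [ha'])
    (by intro k; refine Fin.cases ?_ (fun k => ?_) k; · simpa
        refine Fin.cases ?_ (fun k => ?_) k <;> simp [hab'])
    (by intro k; refine Fin.cases ?_ (fun k => ?_) k; · simpa
        refine Fin.cases ?_ (fun k => ?_) k <;> simp [hb'])
  have hsign : ∀ v : Fin (n+2) → Bool,
      (-1 : ℝ) ^ (Finset.univ.filter fun k => v k = false).card
        = ∏ k, if v k = false then (-1:ℝ) else 1 := by
    intro v; simp [Finset.prod_ite]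
  simp only [hsign] at h
  rw [← (Fin.consEquiv (fun _ : Fin (n+2) => Bool)).sum_comp, Fintype.sum_prod_type] at h
  have key : ∀ x : Bool, (∑ w : Fin (n+1) → Bool,
      (∏ k, if (Fin.consEquiv (fun _ : Fin (n+2) => Bool)) (x, w) k = false then (-1:ℝ) else 1) *
      C (fun k => if (Fin.consEquiv (fun _ : Fin (n+2) => Bool)) (x, w) k then
        (Fin.cons b (Fin.cons b' fun _ => 1) : Fin (n+2) → ℝ) k else
        (Fin.cons a (Fin.cons a' fun _ => 0) : Fin (n+2) → ℝ) k)) =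
      (if x = false then -1 else 1) *
        (C (Fin.cons (if x then b else a) (Fin.cons b' fun _ => 1))
        - C (Fin.cons (if x then b else a) (Fin.cons a' fun _ => 1))) := by
    intro x
    have inner : ∀ y : Bool, (∑ w : Fin n → Bool,
      (∏ k, if (Fin.cons x (Fin.cons y w : Fin (n+1) → Bool) : Fin (n+2) → Bool) k = false then (-1:ℝ) else 1) *
      C (fun k => if (Fin.cons x (Fin.cons y w : Fin (n+1) → Bool) : Fin (n+2) → Bool) k then
        (Fin.cons b (Fin.cons b' fun _ => 1) : Fin (n+2) → ℝ) k else
        (Fin.cons a (Fin.cons a' fun _ => 0) : Fin (n+2) → ℝ) k)) =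
      (if x = false then -1 else 1) * (if y = false then -1 else 1) *
        C (Fin.cons (if x then b else a) (Fin.cons (if y then b' else a') fun _ => 1)) := by
      intro y
      rw [Fintype.sum_eq_single (fun _ => true)]
      · simp only [Fin.prod_univ_succ, Fin.cons_zero, Fin.cons_succ]
        simp only [Bool.true_eq_false, if_false, Finset.prod_const_one, mul_one]
        congr 2
        funext k
        refine Fin.cases ?_ (fun k => ?_) k; · simp
        refine Fin.cases ?_ (fun k => ?_) k <;> simp
      · intro w hw
        obtain ⟨j, hj⟩ := Function.ne_iff.1 hw
        rw [hC.2.1, mul_zero]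
        · intro k
          refine Fin.cases ?_ (fun k => ?_) k
          · cases x <;> simp <;> constructor <;> linarith
          refine Fin.cases ?_ (fun k => ?_) k
          · cases y <;> simp <;> constructor <;> linarith
          · simp; split_ifs <;> simp
        · refine ⟨j.succ.succ, ?_⟩
          simp at hj
          simp [hj]
    rw [← (Fin.consEquiv (fun _ : Fin (n+1) => Bool)).sum_comp, Fintype.sum_prod_type]
    rw [Fintype.sum_bool]
    refine (congrArg₂ (· + ·) (inner true) (inner false)).trans ?_
    cases x <;> simp <;> ring
  rw [Fintype.sum_bool, key, key] at h
  simp at h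
  linarith

theorem aux_convex {n : ℕ} {C : (Fin (n+2) → ℝ) → ℝ} (hC : IsCopula C) {φ : ℝ → ℝ}
    (hg : IsGenerator φ) (hA : IsArchimedean C φ) : ConvexOn ℝ (Ioc (0:ℝ) 1) φ := by
  refine aux_midconvex (convex_Ioc 0 1) hg.1 ?_
  intro x hx y hy hxy
  have hφ : φ y < φ x := hg.2.1 hx hy hxy
  have hy0 : 0 ≤ φ y := by
    rw [← hg.2.2]; exact hg.2.1.antitoneOn hy (by simp) hy.2
  have hC2 : ∀ p ∈ Ioc (0:ℝ) 1, ∀ q ∈ Ioc (0:ℝ) 1,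
      C (Fin.cons p (Fin.cons q fun _ => 1)) = geninv φ (φ p + φ q) := by
    intro p hp q hq
    rw [hA.1]
    · simp [Fin.sum_univ_succ, hg.2.2]
    · intro k
      refine Fin.cases ?_ (fun k => ?_) k
      · simpa using hp
      refine Fin.cases ?_ (fun k => ?_) k
      · simpa using hq
      · simp
  obtain ⟨m, hm, hms⟩ : (φ x + φ y) / 2 ∈ φ '' Icc x y :=
    intermediate_value_Icc' hxy.le (hg.1.mono fun z hz => ⟨hx.1.trans_le hz.1, hz.2.trans hy.2⟩)
      ⟨by linarith, by linarith⟩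
  obtain ⟨e, he, hes⟩ : (φ x - φ y) / 2 ∈ φ '' Icc x 1 :=
    intermediate_value_Icc' hx.2 (hg.1.mono fun z hz => ⟨hx.1.trans_le hz.1, hz.2⟩)
      ⟨by rw [hg.2.2]; linarith, by linarith⟩
  have hm' : m ∈ Ioc (0:ℝ) 1 := ⟨hx.1.trans_le hm.1, hm.2.trans hy.2⟩
  have he' : e ∈ Ioc (0:ℝ) 1 := ⟨hx.1.trans_le he.1, he.2⟩
  have key := aux_two hC hm'.1.le hm.2 hy.2 he'.1.le he'.2 le_rfl
  rw [hC2 m hm' 1 (by simp), hC2 y hy e he', hC2 m hm' e he', hC2 y hy 1 (by simp), hg.2.2,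
    add_zero, add_zero, aux_geninv hg hm', aux_geninv hg hy] at key
  have e1 : φ y + φ e = φ m := by rw [hms, hes]; ring
  have e2 : φ m + φ e = φ x := by rw [hms, hes]; ring
  rw [e1, e2, aux_geninv hg hm', aux_geninv hg hx] at key
  rw [← hms]
  exact hg.2.1.antitoneOn hm' ⟨by linarith [hx.1, hy.1], by linarith [hx.2, hy.2]⟩ (by linarith)

theorem aux_pos {φ : ℝ → ℝ} (hg : IsGenerator φ) {t : ℝ} (h0 : 0 < t) (h1 : t < 1) : 0 < φ t := by
  rw [← hg.2.2]; exact hg.2.1 ⟨h0, h1.le⟩ (by simp) h1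

theorem aux_lower_t {φ : ℝ → ℝ} {α : ENNReal} (hr : RegVarAtZeroE φ α) {β : NNReal}
    (hβ : (β : ENNReal) < α) :
    ∃ t : ℝ, 1 < t ∧ ∀ᶠ s in nhdsWithin (0:ℝ) (Ioi 0), φ (t * s) / φ s < 1 - β * (t - 1) := by
  unfold RegVarAtZeroE at hr
  split_ifs at hr with hα
  · refine ⟨1 + 1 / (β + 1), by simp; positivity, ?_⟩
    refine (hr.2 _ (by simp; positivity)).eventually_lt_const ?_
    have : (0:ℝ) ≤ β := β.2
    have h2 : (1:ℝ) - β * (1 + 1 / (β + 1) - 1) = 1 / (β + 1) := by field_simp; ring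
    rw [h2]; positivity
  · have hβ' : (β : ℝ) < α.toReal := by
      have := (ENNReal.toReal_lt_toReal ENNReal.coe_ne_top hα).2 hβ
      simpa using this
    have hd := Real.hasDerivAt_rpow_const (x := 1) (p := -α.toReal) (Or.inl one_ne_zero)
    have hs := (hasDerivAt_iff_tendsto_slope_left_right.1 hd).2
    have h2 : -α.toReal * (1:ℝ) ^ (-α.toReal - 1) < -(β:ℝ) := by simp; exact hβ'
    obtain ⟨t, ht, ht1⟩ := ((hs.eventually_lt_const h2).and self_mem_nhdsWithin).exists
    have ht1 : 1 < t := ht1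
    refine ⟨t, ht1, (hr t (by linarith)).eventually_lt_const ?_⟩
    rw [slope_def_field, div_lt_iff₀ (by linarith), Real.one_rpow] at ht
    linarith

theorem aux_upper_t {φ : ℝ → ℝ} {α : ENNReal} (hr : RegVarAtZeroE φ α) {β : NNReal}
    (hβ : α < (β : ENNReal)) :
    ∃ t : ℝ, 0 < t ∧ t < 1 ∧
      ∀ᶠ s in nhdsWithin (0:ℝ) (Ioi 0), φ (t * s) / φ s < 1 + β * (1 - t) := by
  have hα : α ≠ ⊤ := (hβ.trans_le le_top).ne
  unfold RegVarAtZeroE at hr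
  rw [if_neg hα] at hr
  have hβ' : α.toReal < (β : ℝ) := by
    have := (ENNReal.toReal_lt_toReal hα ENNReal.coe_ne_top).2 hβ
    simpa using this
  have hd := Real.hasDerivAt_rpow_const (x := 1) (p := -α.toReal) (Or.inl one_ne_zero)
  have hs := (hasDerivAt_iff_tendsto_slope_left_right.1 hd).1
  have h2 : -(β:ℝ) < -α.toReal * (1:ℝ) ^ (-α.toReal - 1) := by simp; exact hβ'
  have h0 : ∀ᶠ t in nhdsWithin (1:ℝ) (Iio 1), 0 < t :=
    mem_nhdsWithin_of_mem_nhds (Ioi_mem_nhds one_pos)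
  obtain ⟨t, ⟨ht, ht1⟩, ht0⟩ :=
    (((hs.eventually_const_lt h2).and self_mem_nhdsWithin).and h0).exists
  have ht1 : t < 1 := ht1
  refine ⟨t, ht0, ht1, (hr t ht0).eventually_lt_const ?_⟩
  rw [slope_def_field, lt_div_iff_of_neg (by linarith), Real.one_rpow] at ht
  linarith

theorem aux_ev {P : ℝ → Prop} (h : ∀ᶠ s in nhdsWithin (0:ℝ) (Ioi 0), P s) :
    ∃ δ : ℝ, 0 < δ ∧ ∀ s, 0 < s → s < δ → P s := by
  obtain ⟨δ, hδ, h⟩ := mem_nhdsGT_iff_exists_Ioo_subset.1 h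
  exact ⟨δ, hδ, fun s h1 h2 => h ⟨h1, h2⟩⟩

theorem aux_lower {φ : ℝ → ℝ} {α : ENNReal} (hg : IsGenerator φ)
    (hc : ConvexOn ℝ (Ioc (0:ℝ) 1) φ) (hr : RegVarAtZeroE φ α) {β : NNReal}
    (hβ : (β : ENNReal) < α) :
    ∃ δ : ℝ, 0 < δ ∧ δ ≤ 1 ∧ ∀ u v, 0 < u → u < v → v < δ →
      φ v * (1 + β * ((v - u) / v)) ≤ φ u := by
  obtain ⟨t, ht, he⟩ := aux_lower_t hr hβ
  obtain ⟨δ, hδ, h⟩ := aux_ev he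
  refine ⟨min δ (1 / t), by positivity, (min_le_right _ _).trans ?_, ?_⟩
  · rw [div_le_one (by linarith)]; exact ht.le
  intro u v hu huv hv
  have hv0 : 0 < v := hu.trans huv
  have h1 := h v hv0 (hv.trans_le (min_le_left _ _))
  have htv : t * v < 1 := by
    have := hv.trans_le (min_le_right _ _)
    rw [lt_div_iff₀ (by linarith)] at this
    linarith
  have hvt : v < t * v := by nlinarith
  have hp := aux_pos hg hv0 (hvt.trans htv)
  rw [div_lt_iff₀ hp] at h1
  have hs := hc.slope_mono_adjacent (x := u) (y := v) (z := t * v) ⟨hu, by linarith⟩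
    ⟨by linarith, htv.le⟩ huv hvt
  have h3 : (φ (t * v) - φ v) / (t * v - v) ≤ - (β * φ v / v) := by
    rw [div_le_iff₀ (by linarith)]
    have : -(β * φ v / v) * (t * v - v) = - (β * (t - 1) * φ v) := by field_simp
    rw [this]; linarith
  have h4 := hs.trans h3
  rw [div_le_iff₀ (by linarith)] at h4
  have : φ v * (1 + β * ((v - u) / v)) = φ v + β * φ v / v * (v - u) := by field_simp
  rw [this]; linarith

theorem aux_upper {φ : ℝ → ℝ} {α : ENNReal} (hg : IsGenerator φ)
    (hc : ConvexOn ℝ (Ioc (0:ℝ) 1) φ) (hr : RegVarAtZeroE φ α) {β : NNReal}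
    (hβ : α < (β : ENNReal)) :
    ∃ δ : ℝ, 0 < δ ∧ δ ≤ 1 ∧ ∀ u v, 0 < u → u < v → v < δ →
      φ u * (1 - β * ((v - u) / u)) ≤ φ v := by
  obtain ⟨t, ht0, ht, he⟩ := aux_upper_t hr hβ
  obtain ⟨δ, hδ, h⟩ := aux_ev he
  refine ⟨min δ 1, by positivity, min_le_right _ _, ?_⟩
  intro u v hu huv hv
  have h1 := h u hu ((huv.trans hv).trans_le (min_le_left _ _))
  have hv1 : v < 1 := hv.trans_le (min_le_right _ _)
  have htu : t * u < u := by nlinarith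
  have htu0 : 0 < t * u := by positivity
  have hp := aux_pos hg hu (huv.trans hv1)
  rw [div_lt_iff₀ hp] at h1
  have hs := hc.slope_mono_adjacent (x := t * u) (y := u) (z := v) ⟨htu0, by linarith⟩
    ⟨by linarith, hv1.le⟩ htu huv
  have h3 : - (β * φ u / u) ≤ (φ u - φ (t * u)) / (u - t * u) := by
    rw [le_div_iff₀ (by linarith)]
    have : -(β * φ u / u) * (u - t * u) = - (β * (1 - t) * φ u) := by field_simp
    rw [this]; linarith
  have h4 := h3.trans hs
  rw [le_div_iff₀ (by linarith)] at h4
  have : φ u * (1 - β * ((v - u) / u)) = φ u - β * φ u / u * (v - u) := by field_simp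
  rw [this]; linarith

/-- the quotient `φ2 / φ1` is antitone near `0` -/
theorem aux_ratio {φ1 φ2 : ℝ → ℝ} {α1 α2 : ENNReal} (hg1 : IsGenerator φ1) (hg2 : IsGenerator φ2)
    (hc1 : ConvexOn ℝ (Ioc (0:ℝ) 1) φ1) (hc2 : ConvexOn ℝ (Ioc (0:ℝ) 1) φ2)
    (hr1 : RegVarAtZeroE φ1 α1) (hr2 : RegVarAtZeroE φ2 α2) (hα : α1 < α2) :
    ∃ δ : ℝ, 0 < δ ∧ δ ≤ 1 ∧ ∀ u v, 0 < u → u ≤ v → v < δ → φ2 v / φ1 v ≤ φ2 u / φ1 u := by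
  obtain ⟨γ, hγ1, hγ2⟩ := ENNReal.lt_iff_exists_nnreal_btwn.1 hα
  obtain ⟨β, hβ1, hβ2⟩ := ENNReal.lt_iff_exists_nnreal_btwn.1 hγ2
  have hγβ : (γ:ℝ) < β := by exact_mod_cast hβ1
  have hγ0 : (0:ℝ) ≤ γ := γ.2
  obtain ⟨δ1, hδ1, hδ1', H1⟩ := aux_upper hg1 hc1 hr1 hγ1
  obtain ⟨δ2, hδ2, hδ2', H2⟩ := aux_lower hg2 hc2 hr2 hβ2
  have hβ0 : (0:ℝ) < β := by linarith
  set h : ℝ := (β - γ) / (γ + β * γ + 1) with hh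
  have hden : (0:ℝ) < γ + β * γ + 1 := by positivity
  have hpos : 0 < h := div_pos (by linarith) hden
  have hhm : h * (γ + β * γ + 1) = β - γ := by rw [hh]; field_simp
  refine ⟨min δ1 δ2, lt_min hδ1 hδ2, (min_le_left _ _).trans hδ1', ?_⟩
  have step : ∀ u v, 0 < u → u ≤ v → v < min δ1 δ2 → v ≤ u * (1 + h) →
      φ2 v / φ1 v ≤ φ2 u / φ1 u := by
    intro u v hu huv hv hvh
    rcases huv.eq_or_lt with rfl | huv
    · exact le_rfl
    have hv1 := hv.trans_le (min_le_left _ _)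
    have hv2 := hv.trans_le (min_le_right _ _)
    have hv0 := hu.trans huv
    have k1 := H1 u v hu huv hv1
    have k2 := H2 u v hu huv hv2
    have p1 := aux_pos hg1 hu (by linarith)
    have p1' := aux_pos hg1 hv0 (by linarith)
    have p2' := aux_pos hg2 hv0 (by linarith)
    rw [div_le_div_iff₀ p1' p1]
    set A := 1 + β * ((v - u) / v) with hA
    set B := 1 - γ * ((v - u) / u) with hB
    have hA0 : 0 < A := by
      have : 0 < (v - u) / v := div_pos (by linarith) hv0
      positivity
    have hAB : 1 ≤ A * B := by
      have : A * B - 1 = (v - u) / (u * v) * (β * u - γ * v - β * γ * (v - u)) := by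
        rw [hA, hB]; field_simp; ring
      have h5 : 0 ≤ β * u - γ * v - β * γ * (v - u) := by
        have e1 : γ * v ≤ γ * (u * (1 + h)) := mul_le_mul_of_nonneg_left hvh hγ0
        have e2 : β * γ * (v - u) ≤ β * γ * (u * h) :=
          mul_le_mul_of_nonneg_left (by linarith) (by positivity)
        have e3 : u * (h * (γ + β * γ + 1)) = u * (β - γ) := by rw [hhm]
        nlinarith [mul_pos hu hpos]
      have h6 : 0 ≤ (v - u) / (u * v) := div_nonneg (by linarith) (by positivity)
      have := mul_nonneg h6 h5
      linarith
    calc φ2 v * φ1 u ≤ φ2 v * φ1 u * (A * B) := le_mul_of_one_le_right (by positivity) hAB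
      _ = (φ2 v * A) * (φ1 u * B) := by ring
      _ ≤ (φ2 v * A) * φ1 v := mul_le_mul_of_nonneg_left k1 (by positivity)
      _ ≤ φ2 u * φ1 v := mul_le_mul_of_nonneg_right k2 p1'.le
  have chain : ∀ n : ℕ, ∀ u v, 0 < u → u ≤ v → v < min δ1 δ2 → v ≤ u * (1 + h) ^ n →
      φ2 v / φ1 v ≤ φ2 u / φ1 u := by
    intro n
    induction n with
    | zero =>
      intro u v hu huv hv hvh
      have : u = v := le_antisymm huv (by simpa using hvh)
      rw [this]
    | succ n ih =>
      intro u v hu huv hv hvh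
      have h1 : v / (1 + h) ≤ v := div_le_self (by linarith) (by linarith)
      have h2 : v / (1 + h) ≤ u * (1 + h) ^ n := by
        rw [div_le_iff₀ (by linarith)]; rw [pow_succ] at hvh; linarith
      have h3 : u ≤ u * (1 + h) ^ n := le_mul_of_one_le_right hu.le (one_le_pow₀ (by linarith))
      have hmv : max u (v / (1 + h)) ≤ v := max_le huv h1
      refine (step (max u (v / (1 + h))) v (lt_max_of_lt_left hu) hmv hv ?_).trans
        (ih u _ hu (le_max_left _ _) (hmv.trans_lt hv) (max_le h3 h2))
      rw [← div_le_iff₀ (by linarith)]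
      exact le_max_right _ _
  intro u v hu huv hv
  obtain ⟨n, hn⟩ := pow_unbounded_of_one_lt (v / u) (show 1 < 1 + h by linarith)
  refine chain n u v hu huv hv ?_
  rw [div_lt_iff₀ hu] at hn
  linarith

theorem aux_set_bdd (φ : ℝ → ℝ) (x : ℝ) : BddBelow {t | t ∈ Ioc (0:ℝ) 1 ∧ φ t ≤ x} :=
  ⟨0, fun _ ht => ht.1.1.le⟩

theorem aux_alpha {n : ℕ} {C1 C2 Λ1 Λ2 : (Fin (n+2) → ℝ) → ℝ}
    {φ1 φ2 : ℝ → ℝ} {α1 α2 : ENNReal}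
    (hC1 : IsCopula C1)
    (hg1 : IsGenerator φ1) (hg2 : IsGenerator φ2)
    (ha1 : IsArchimedean C1 φ1) (ha2 : IsArchimedean C2 φ2)
    (hr1 : RegVarAtZeroE φ1 α1) (hr2 : RegVarAtZeroE φ2 α2)
    (hT1 : HasTDF C1 Λ1) (hT2 : HasTDF C2 Λ2)
    (hlt : Λ1 (fun _ => 1) < Λ2 (fun _ => 1)) : α1 < α2 := by
  have T1 := hT1 (fun _ => 1) (fun _ => zero_le_one)
  have T2 := hT2 (fun _ => 1) (fun _ => zero_le_one)
  set w : Fin (n+2) → ℝ := fun _ => 1 with hw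
  have hsm : ∀ᶠ s in nhdsWithin (0:ℝ) (Ioi 0), 0 < s ∧ s < 1 := by
    filter_upwards [self_mem_nhdsWithin, mem_nhdsWithin_of_mem_nhds (Iio_mem_nhds one_pos)]
      with s h1 h2 using ⟨h1, h2⟩
  have hΛ0 : 0 ≤ Λ1 w := by
    refine ge_of_tendsto T1 ?_
    filter_upwards [hsm] with s hs
    refine div_nonneg (hC1.1 _ fun k => ?_).1 hs.1.le
    simp [hs.1.le, hs.2.le]
  obtain ⟨a, ha, haΛ⟩ := exists_between hlt
  obtain ⟨b, hb, hbΛ⟩ := exists_between haΛ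
  have ha0 : 0 < a := hΛ0.trans_lt ha
  have hb0 : 0 < b := ha0.trans hb
  have E1 : ∀ᶠ s in nhdsWithin (0:ℝ) (Ioi 0), φ1 (a * s) / φ1 s ≤ (n + 2 : ℝ) := by
    have hsm2 : ∀ᶠ s in nhdsWithin (0:ℝ) (Ioi 0), s < 1 / a :=
      mem_nhdsWithin_of_mem_nhds (Iio_mem_nhds (by positivity))
    filter_upwards [hsm, hsm2, T1.eventually_lt_const ha] with s hs hs2 h
    have hp := aux_pos hg1 hs.1 hs.2
    rw [lt_div_iff₀ ha0] at hs2
    rw [div_lt_iff₀ hs.1, ha1.1 _ (by intro k; simpa using ⟨hs.1, hs.2.le⟩)] at h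
    rw [div_le_iff₀ hp]
    have hsum : (∑ k : Fin (n+2), φ1 (s * w k)) = (n + 2) * φ1 s := by simp [hw]
    rw [hsum] at h
    have hne : ({t | t ∈ Ioc (0:ℝ) 1 ∧ φ1 t ≤ (n+2) * φ1 s}).Nonempty :=
      ⟨1, by simp, by rw [hg1.2.2]; positivity⟩
    obtain ⟨t, ⟨ht, ht2⟩, hta⟩ := exists_lt_of_csInf_lt hne h
    refine le_trans (hg1.2.1.antitoneOn ht ⟨by nlinarith [hs.1], by linarith⟩ hta.le) ht2
  have E2 : ∀ᶠ s in nhdsWithin (0:ℝ) (Ioi 0), b < 1 ∧ (n + 2 : ℝ) ≤ φ2 (b * s) / φ2 s := by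
    filter_upwards [hsm, T2.eventually_const_lt hbΛ] with s hs h
    have hp := aux_pos hg2 hs.1 hs.2
    rw [lt_div_iff₀ hs.1, ha2.1 _ (by intro k; simpa using ⟨hs.1, hs.2.le⟩)] at h
    rw [le_div_iff₀ hp]
    have hsum : (∑ k : Fin (n+2), φ2 (s * w k)) = (n + 2) * φ2 s := by simp [hw]
    rw [hsum] at h
    have hmem : ∀ t ∈ Ioc (0:ℝ) 1, φ2 t ≤ (n+2) * φ2 s → b * s < t := fun t ht ht2 =>
      h.trans_le (csInf_le (aux_set_bdd _ _) ⟨ht, ht2⟩)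
    have hb1 : b * s < s := hmem s ⟨hs.1, hs.2.le⟩ (by nlinarith [n.cast_nonneg (α := ℝ)])
    refine ⟨by nlinarith [hs.1], ?_⟩
    by_contra hcon
    push Not at hcon
    exact lt_irrefl _ (hmem (b * s) ⟨mul_pos hb0 hs.1, by linarith⟩ hcon.le)
  have hb1 : b < 1 := by
    obtain ⟨s, hs⟩ := E2.exists
    exact hs.1
  have E2' := E2.mono fun s hs => hs.2
  unfold RegVarAtZeroE at hr1 hr2
  have hα1 : α1 ≠ ⊤ := by
    intro h
    rw [if_pos h] at hr1
    have := hr1.1 a ha0 (hb.trans hb1)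
    obtain ⟨s, h1, h2⟩ := (E1.and (this.eventually_gt_atTop (n+2:ℝ))).exists
    linarith
  by_cases hα2 : α2 = ⊤
  · rw [hα2]; exact lt_top_iff_ne_top.2 hα1
  rw [if_neg hα1] at hr1
  rw [if_neg hα2] at hr2
  have L1 := le_of_tendsto (hr1 a ha0) E1
  have L2 := ge_of_tendsto (hr2 b hb0) E2'
  by_contra hcon
  push Not at hcon
  have hle : α2.toReal ≤ α1.toReal := (ENNReal.toReal_le_toReal hα2 hα1).2 hcon
  have hpos : 0 < α2.toReal := by
    rcases (ENNReal.toReal_nonneg (a := α2)).eq_or_lt with h | h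
    · rw [← h] at L2
      simp at L2
      linarith [n.cast_nonneg (α := ℝ)]
    · exact h
  have h1 : a ^ (-α2.toReal) ≤ a ^ (-α1.toReal) :=
    Real.rpow_le_rpow_of_exponent_ge ha0 (by linarith) (by linarith)
  have h2 : b ^ (-α2.toReal) < a ^ (-α2.toReal) :=
    Real.rpow_lt_rpow_of_neg ha0 hb (by linarith)
  linarith

/-- For Archimedean d-copulas with regularly varying generators, the strict
tail dependence order implies local stochastic dominance. -/
theorem stmt16 {d : ℕ} (hd : 0 < d) (C1 C2 Λ1 Λ2 : (Fin d → ℝ) → ℝ)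
    (φ1 φ2 : ℝ → ℝ) (α1 α2 : ENNReal)
    (hC1 : IsCopula C1) (hC2 : IsCopula C2)
    (hg1 : IsGenerator φ1) (hg2 : IsGenerator φ2)
    (ha1 : IsArchimedean C1 φ1) (ha2 : IsArchimedean C2 φ2)
    (hr1 : RegVarAtZeroE φ1 α1) (hr2 : RegVarAtZeroE φ2 α2)
    (hT1 : HasTDF C1 Λ1) (hT2 : HasTDF C2 Λ2)
    (hlt : ∀ w : Fin d → ℝ, (∀ k, 0 < w k) → Λ1 w < Λ2 w) :
    ∃ ε : ℝ, 0 < ε ∧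
      ∀ u : Fin d → ℝ, (∀ k, u k ∈ Icc (0:ℝ) 1) → ‖u‖ < ε → C1 u ≤ C2 u := by
  obtain ⟨d, rfl⟩ : ∃ e, d = e + 1 := ⟨d - 1, by omega⟩
  rcases d with _ | n
  · refine ⟨1, one_pos, fun u hu _ => ?_⟩
    rw [hC1.2.2.1 u hu 0 (fun l hl => absurd (Fin.ext (by omega)) hl),
      hC2.2.2.1 u hu 0 (fun l hl => absurd (Fin.ext (by omega)) hl)]
  have hα : α1 < α2 := aux_alpha hC1 hg1 hg2 ha1 ha2 hr1 hr2 hT1 hT2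
    (hlt _ fun _ => one_pos)
  obtain ⟨δ, hδ, hδ1, H⟩ := aux_ratio hg1 hg2 (aux_convex hC1 hg1 ha1) (aux_convex hC2 hg2 ha2)
    hr1 hr2 hα
  refine ⟨δ, hδ, fun u hu hnorm => ?_⟩
  by_cases h0 : ∃ k, u k = 0
  · rw [ha1.2 u hu h0, ha2.2 u hu h0]
  push Not at h0
  have hsm : ∀ k, u k < δ := fun k =>
    (le_abs_self _).trans_lt ((norm_le_pi_norm u k).trans_lt hnorm)
  have hpos : ∀ k, 0 < u k := fun k => lt_of_le_of_ne (hu k).1 (h0 k).symm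
  have hI : ∀ k, u k ∈ Ioc (0:ℝ) 1 := fun k => ⟨hpos k, (hu k).2⟩
  have p1 : ∀ k, 0 < φ1 (u k) := fun k => aux_pos hg1 (hpos k) ((hsm k).trans_le hδ1)
  have p2 : ∀ k, 0 < φ2 (u k) := fun k => aux_pos hg2 (hpos k) ((hsm k).trans_le hδ1)
  refine le_of_forall_lt fun s hs => ?_
  obtain ⟨t, hst, ht⟩ := exists_between hs
  refine hst.trans_le ?_
  rcases le_or_gt t 0 with ht0 | ht0
  · exact ht0.trans (hC2.1 u hu).1
  rw [ha1.1 u hI] at ht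
  have hle : ∀ r ∈ Ioc (0:ℝ) 1, φ1 r ≤ ∑ k, φ1 (u k) → t < r := fun r hr h =>
    ht.trans_le (csInf_le (aux_set_bdd _ _) ⟨hr, h⟩)
  have htu : ∀ k, t < u k := fun k => hle _ (hI k)
    (Finset.single_le_sum (f := fun k => φ1 (u k)) (fun i _ => (p1 i).le) (Finset.mem_univ k))
  have ht1 : t < 1 := (htu 0).trans_le (hu 0).2
  have hS : ∑ k, φ1 (u k) < φ1 t := by
    by_contra hcon
    push Not at hcon
    exact lt_irrefl _ (hle t ⟨ht0, ht1.le⟩ hcon)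
  have q1 := aux_pos hg1 ht0 ht1
  have q2 := aux_pos hg2 ht0 ht1
  have hS2 : ∑ k, φ2 (u k) ≤ φ2 t := by
    calc ∑ k, φ2 (u k) ≤ ∑ k, φ2 t / φ1 t * φ1 (u k) := by
          refine Finset.sum_le_sum fun k _ => ?_
          have := H t (u k) ht0 (htu k).le (hsm k)
          rwa [div_le_iff₀ (p1 k)] at this
      _ = φ2 t / φ1 t * ∑ k, φ1 (u k) := by rw [Finset.mul_sum]
      _ ≤ φ2 t / φ1 t * φ1 t := mul_le_mul_of_nonneg_left hS.le (by positivity)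
      _ = φ2 t := by field_simp
  rw [ha2.1 u hI]
  refine le_csInf ⟨1, by simp, ?_⟩ ?_
  · rw [hg2.2.2]; exact Finset.sum_nonneg fun k _ => (p2 k).le
  · rintro r ⟨hr, hr2⟩
    exact (hg2.2.1.le_iff_ge hr ⟨ht0, ht1.le⟩).1 (hr2.trans hS2)
end
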